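/- For functions on ℝ², ‖ |∇|^{−1}(⟨ψ₁,ψ₂⟩) ψ₃ ‖_{L²(ℝ²)} ≲ ‖ψ₁‖_{H^{1/3}(ℝ²)} ‖ψ₂‖_{H^{1/3}(ℝ²)} ‖ψ₃‖_{H^{1/3}(ℝ²)}, where ψ₁, ψ₂, ψ₃ : ℝ² → ℂ² and ⟨·,·⟩ is the ℂ² inner product. -/

import Mathlib

open MeasureTheory FourierTransform SchwartzMap
open scoped ENNReal NNReal

noncomputable section

/-- The ℂ² inner product ⟨u,v⟩ = ū₁v₁ + ū₂v₂. -/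
def dotc (u v : Fin 2 → ℂ) : ℂ := ∑ i, (starRingEnd ℂ) (u i) * v i

/-- The inhomogeneous Sobolev norm ‖f‖_{H^s(ℝ²)} on the Fourier side,
for vector-valued f. -/
def sobNorm {F : Type*} [NormedAddCommGroup F] [NormedSpace ℂ F]
    (s : ℝ) (f : EuclideanSpace ℝ (Fin 2) → F) : ℝ≥0∞ :=
  (∫⁻ ξ, ENNReal.ofReal ((1 + ‖ξ‖ ^ 2) ^ s * ‖𝓕 f ξ‖ ^ 2)) ^ (1 / 2 : ℝ)

/-- |∇|⁻¹, the Fourier multiplier |ξ|⁻¹. -/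
def invAbs (g : EuclideanSpace ℝ (Fin 2) → ℂ) (x : EuclideanSpace ℝ (Fin 2)) : ℂ :=
  𝓕⁻ (fun ξ => ((‖ξ‖ : ℂ))⁻¹ * 𝓕 g ξ) x

local notation "Plane" => EuclideanSpace ℝ (Fin 2)

theorem continuous_fourierInv_of_integrable {h : Plane → ℂ} (hh : Integrable h) :
    Continuous (𝓕⁻ h) := by
  rw [Real.fourierInv_eq_fourier_comp_neg]
  exact VectorFourier.fourierIntegral_continuous Real.continuous_fourierChar
    (by exact continuous_inner) hh.comp_neg

theorem enorm_fourierInv_le_lintegral (h : Plane → ℂ) (x : Plane) :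
    ‖𝓕⁻ h x‖ₑ ≤ ∫⁻ ξ, ‖h ξ‖ₑ := by
  rw [Real.fourierInv_eq]
  refine (enorm_integral_le_lintegral_enorm _).trans_eq ?_
  refine lintegral_congr fun ξ => ?_
  rw [← ofReal_norm, ← ofReal_norm, Circle.norm_smul]

theorem fourierInv_add_of_integrable {f g : Plane → ℂ} (hf : Integrable f) (hg : Integrable g) :
    𝓕⁻ (f + g) = 𝓕⁻ f + 𝓕⁻ g := by
  simp only [Real.fourierInv_eq_fourier_comp_neg]
  exact VectorFourier.fourierIntegral_add Real.continuous_fourierChar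
    (by exact continuous_inner) hf.comp_neg hg.comp_neg

theorem integral_fourier_mul_eq_of_integrable {f g : Plane → ℂ} (hf : Integrable f)
    (hg : Integrable g) : ∫ ξ, 𝓕 f ξ * g ξ = ∫ x, f x * 𝓕 g x := by
  have := VectorFourier.integral_fourierIntegral_smul_eq_flip (L := innerₗ Plane)
    Real.continuous_fourierChar (by exact continuous_inner) hf hg
  rw [flip_innerₗ] at this
  exact this

theorem integral_mul_fourierInv_eq_of_integrable {f g : Plane → ℂ} (hf : Integrable f)
    (hg : Integrable g) : ∫ x, f x * 𝓕⁻ g x = ∫ ξ, 𝓕⁻ f ξ * g ξ := by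
  rw [Real.fourierInv_eq_fourier_comp_neg f,
    integral_fourier_mul_eq_of_integrable hf.comp_neg hg, ← integral_neg_eq_self]
  simp only [Real.fourierInv_eq_fourier_neg, neg_neg]

theorem lintegral_enorm_fourierInv_sq_le {h : Plane → ℂ} (hh : Integrable h) :
    ∫⁻ x, ‖𝓕⁻ h x‖ₑ ^ 2 ≤ ∫⁻ ξ, ‖h ξ‖ₑ ^ 2 := by
  by_cases h2 : MemLp h 2
  swap
  · have : ∫⁻ ξ, ‖h ξ‖ₑ ^ 2 = ∞ := by
      by_contra hne
      refine h2 ⟨hh.1, ?_⟩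
      rw [eLpNorm_lt_top_iff_lintegral_rpow_enorm_lt_top (by simp) (by simp)]
      simpa using lt_top_iff_ne_top.2 hne
    simp [this]
  · have key : 𝓕⁻ h =ᵐ[volume] (𝓕⁻ (h2.toLp h) : Lp ℂ 2 (volume : Measure Plane)) := by
      apply ae_eq_of_integral_contDiff_smul_eq
        (continuous_fourierInv_of_integrable hh).locallyIntegrable
        ((Lp.memLp _).locallyIntegrable (by norm_num))
      intro g hg hgc
      have hgc' : HasCompactSupport (fun x => (g x : ℂ)) := hgc.comp_left (g := fun r : ℝ => (r : ℂ)) (by simp)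
      have hgd : ContDiff ℝ (⊤ : ℕ∞) (fun x => (g x : ℂ)) := Complex.ofRealCLM.contDiff.comp hg
      let G : 𝓢(Plane, ℂ) := hgc'.toSchwartzMap hgd
      have hG : ∀ x, G x = g x := fun x => rfl
      have := congrArg (fun T => T G) (Lp.fourierInv_toTemperedDistribution_eq (h2.toLp h))
      simp only [TemperedDistribution.fourierInv_apply, Lp.toTemperedDistribution_apply, smul_eq_mul, hG] at this
      simp only [Complex.real_smul]
      rw [← this, integral_mul_fourierInv_eq_of_integrable (f := fun x => (g x : ℂ))
        G.integrable hh]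
      refine integral_congr_ae ?_
      filter_upwards [h2.coeFn_toLp] with ξ hξ
      rw [hξ, SchwartzMap.fourierInv_coe]
      rfl
    have hnorm : eLpNorm (𝓕⁻ h) 2 volume = eLpNorm h 2 volume := by
      rw [eLpNorm_congr_ae key, ← Lp.enorm_def, ← eLpNorm_congr_ae h2.coeFn_toLp, ← Lp.enorm_def,
        ← ofReal_norm, ← ofReal_norm]
      congr 1
      rw [← Lp.norm_fourier_eq, FourierTransform.fourier_fourierInv_eq]
    rw [eLpNorm_eq_lintegral_rpow_enorm_toReal (by simp) (by simp),
      eLpNorm_eq_lintegral_rpow_enorm_toReal (by simp) (by simp)] at hnorm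
    have := (ENNReal.rpow_left_injective (x := 1 / (2 : ℝ≥0∞).toReal) (by simp)) hnorm
    simpa using this.le

theorem exists_lintegral_ball_norm_rpow_le {s : ℝ} (hs : s < 1) :
    ∃ K : ℝ, 0 < K ∧ ∀ R : ℝ, 0 < R →
      ∫⁻ x in Metric.ball (0 : Plane) R, ENNReal.ofReal (‖x‖ ^ (-(2 * s))) ≤
        ENNReal.ofReal (K * R ^ (1 - s)) ^ 2 := by
  set I : ℝ := ∫ x in Metric.ball (0 : Plane) 1, ‖x‖ ^ (-(2 * s))
  have hI : 0 ≤ I := integral_nonneg fun x => by positivity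
  refine ⟨√I + 1, by positivity, fun R hR => ?_⟩
  have hint : IntegrableOn (fun x : Plane => ‖x‖ ^ (-(2 * s))) (Metric.ball 0 R) :=
    integrableOn_ball_of_norm_le_rpow (C := 1) (α := 2 * s) (by simp) (by simp; linarith)
      (.of_forall fun x => by rw [Real.norm_of_nonneg (by positivity)]; simp)
      (measurable_norm.pow_const _).aestronglyMeasurable
  rw [← ofReal_integral_eq_lintegral_ofReal hint (.of_forall fun x => by positivity)]
  have h1 := Measure.setIntegral_comp_smul_of_pos (volume : Measure Plane)
    (fun x => ‖x‖ ^ (-(2 * s))) (Metric.ball 0 1) hR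
  rw [smul_unitBall_of_pos hR] at h1
  have h2 : ∀ x : Plane, ‖R • x‖ ^ (-(2 * s)) = R ^ (-(2 * s)) * ‖x‖ ^ (-(2 * s)) := fun x => by
    rw [norm_smul, Real.norm_of_nonneg hR.le, Real.mul_rpow hR.le (norm_nonneg x)]
  simp only [h2, integral_const_mul, finrank_euclideanSpace, Fintype.card_fin, smul_eq_mul] at h1
  rw [eq_inv_mul_iff_mul_eq₀ (by positivity)] at h1
  rw [← h1]
  rw [← ENNReal.ofReal_pow (by positivity)]
  apply ENNReal.ofReal_le_ofReal
  have h3 : (R ^ (1 - s)) ^ 2 = R ^ 2 * R ^ (-(2 * s)) := by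
    rw [← Real.rpow_natCast, ← Real.rpow_natCast, ← Real.rpow_mul hR.le, ← Real.rpow_add hR]
    congr 1
    push_cast
    ring
  rw [mul_pow, h3]
  have h4 : I ≤ (√I + 1) ^ 2 := by nlinarith [Real.sq_sqrt hI, Real.sqrt_nonneg I]
  calc R ^ 2 * (R ^ (-(2 * s)) * I) = I * (R ^ 2 * R ^ (-(2 * s))) := by ring
    _ ≤ _ := by gcongr

theorem lintegral_enorm_ball_le {s K R : ℝ}
    (hK : ∫⁻ x in Metric.ball (0 : Plane) R, ENNReal.ofReal (‖x‖ ^ (-(2 * s))) ≤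
        ENNReal.ofReal (K * R ^ (1 - s)) ^ 2) {h : Plane → ℂ} (hh : AEStronglyMeasurable h) :
    ∫⁻ ξ in Metric.ball (0 : Plane) R, ‖h ξ‖ₑ ≤
      ENNReal.ofReal (K * R ^ (1 - s)) * (∫⁻ ξ, ‖ξ‖ₑ ^ (2 * s) * ‖h ξ‖ₑ ^ 2) ^ (1 / 2 : ℝ) := by
  have h0 : ∀ᵐ x : Plane, x ≠ 0 := by simp [ae_iff]
  have hcs := ENNReal.lintegral_mul_le_Lp_mul_Lq
    (volume.restrict (Metric.ball (0 : Plane) R)) Real.HolderConjugate.two_two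
    (f := fun ξ => ‖ξ‖ₑ ^ (-s)) (g := fun ξ => ‖ξ‖ₑ ^ s * ‖h ξ‖ₑ)
    (by fun_prop) (AEMeasurable.mul (by fun_prop) hh.restrict.enorm)
  refine le_trans (le_of_eq ?_) (hcs.trans (mul_le_mul' ?_ ?_))
  · refine lintegral_congr_ae (ae_restrict_of_ae ?_)
    filter_upwards [h0] with ξ hξ
    have hξ' : ‖ξ‖ₑ ≠ 0 := by simpa using hξ
    simp only [Pi.mul_apply]
    rw [← mul_assoc, ← ENNReal.rpow_add _ _ hξ' (by simp), neg_add_cancel, ENNReal.rpow_zero,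
      one_mul]
  · rw [one_div, ENNReal.rpow_inv_le_iff (by norm_num)]
    refine le_trans (le_of_eq ?_) (hK.trans_eq (by simp))
    refine lintegral_congr_ae (ae_restrict_of_ae ?_)
    filter_upwards [h0] with ξ hξ
    rw [← ENNReal.ofReal_rpow_of_pos (by simpa using hξ), ofReal_norm, ← ENNReal.rpow_mul]
    congr 1
    ring
  · refine ENNReal.rpow_le_rpow (le_trans (setLIntegral_le_lintegral _ _) (le_of_eq ?_))
      (by norm_num)
    refine lintegral_congr fun ξ => ?_
    rw [ENNReal.mul_rpow_of_nonneg _ _ (by norm_num), ← ENNReal.rpow_mul, mul_comm s]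
    simp

theorem measure_lt_norm_fourierInv_le {s K N : ℝ} (hs : s < 1) (hK0 : 0 < K) (hN : 0 < N)
    (hK : ∀ R : ℝ, 0 < R →
      ∫⁻ x in Metric.ball (0 : Plane) R, ENNReal.ofReal (‖x‖ ^ (-(2 * s))) ≤
        ENNReal.ofReal (K * R ^ (1 - s)) ^ 2) {h : Plane → ℂ} (hh : Integrable h)
    (hhN : (∫⁻ ξ, ‖ξ‖ₑ ^ (2 * s) * ‖h ξ‖ₑ ^ 2) ^ (1 / 2 : ℝ) = ENNReal.ofReal N)
    {t : ℝ} (ht : 0 < t) :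
    volume {x | t < ‖𝓕⁻ h x‖} ≤ ENNReal.ofReal (4 * t ^ (-2 : ℝ)) *
      ∫⁻ ξ, {ξ : Plane | t ≤ 2 * K * N * ‖ξ‖ ^ (1 - s)}.indicator (fun ξ => ‖h ξ‖ₑ ^ 2) ξ := by
  set S := {ξ : Plane | t ≤ 2 * K * N * ‖ξ‖ ^ (1 - s)}
  have hS : MeasurableSet S := measurableSet_le measurable_const
    ((measurable_norm.pow_const _).const_mul _)
  have hs' : 0 < 1 - s := by linarith
  set R : ℝ := (t / (2 * K * N)) ^ (1 - s)⁻¹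
  have hR : 0 < R := by positivity
  have hRs : R ^ (1 - s) = t / (2 * K * N) := Real.rpow_inv_rpow (by positivity) hs'.ne'
  have hSR : Sᶜ ⊆ Metric.ball 0 R := by
    intro ξ hξ
    simp only [S, Set.mem_compl_iff, Set.mem_ofPred_eq, not_le] at hξ
    rw [mem_ball_zero_iff, ← Real.rpow_lt_rpow_iff (norm_nonneg _) hR.le hs', hRs,
      lt_div_iff₀ (by positivity)]
    linarith
  have hlow : ∀ x, ‖𝓕⁻ (Sᶜ.indicator h) x‖ ≤ t / 2 := by
    intro x
    have : ‖𝓕⁻ (Sᶜ.indicator h) x‖ₑ ≤ ENNReal.ofReal (t / 2) := by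
      calc _ ≤ ∫⁻ ξ, ‖Sᶜ.indicator h ξ‖ₑ := enorm_fourierInv_le_lintegral _ x
        _ = ∫⁻ ξ in Sᶜ, ‖h ξ‖ₑ := by
          rw [← lintegral_indicator hS.compl]
          simp only [enorm_indicator_eq_indicator_enorm]
        _ ≤ ∫⁻ ξ in Metric.ball (0 : Plane) R, ‖h ξ‖ₑ := lintegral_mono_set hSR
        _ ≤ _ := lintegral_enorm_ball_le (hK R hR) hh.1
        _ = _ := by
          rw [hhN, hRs, ← ENNReal.ofReal_mul (by positivity)]
          congr 1
          field_simp
    rwa [← ofReal_norm, ENNReal.ofReal_le_ofReal_iff (by positivity)] at this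
  have hsum : ∀ x, 𝓕⁻ h x = 𝓕⁻ (S.indicator h) x + 𝓕⁻ (Sᶜ.indicator h) x := fun x => by
    rw [← Pi.add_apply, ← fourierInv_add_of_integrable (hh.indicator hS) (hh.indicator hS.compl),
      Set.indicator_self_add_compl]
  have hsub : {x | t < ‖𝓕⁻ h x‖} ⊆
      {x | ENNReal.ofReal (t / 2) ^ 2 ≤ ‖𝓕⁻ (S.indicator h) x‖ₑ ^ 2} := by
    intro x hx
    simp only [Set.mem_ofPred_eq] at hx ⊢
    gcongr
    rw [← ofReal_norm]
    apply ENNReal.ofReal_le_ofReal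
    have := norm_add_le (𝓕⁻ (S.indicator h) x) (𝓕⁻ (Sᶜ.indicator h) x)
    rw [← hsum] at this
    linarith [hlow x]
  have ht2 : ENNReal.ofReal (t / 2) ^ 2 = (ENNReal.ofReal (4 * t ^ (-2 : ℝ)))⁻¹ := by
    rw [← ENNReal.ofReal_inv_of_pos (by positivity), ← ENNReal.ofReal_pow (by positivity)]
    congr 1
    rw [Real.rpow_neg ht.le, Real.rpow_two]
    field_simp
    norm_num
  calc _ ≤ _ := measure_mono hsub
    _ ≤ (∫⁻ x, ‖𝓕⁻ (S.indicator h) x‖ₑ ^ 2) / ENNReal.ofReal (t / 2) ^ 2 := by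
      refine meas_ge_le_lintegral_div ?_ (by simpa using ht) (by simp)
      exact ((continuous_fourierInv_of_integrable (hh.indicator hS)).enorm.measurable.pow_const
        2).aemeasurable
    _ ≤ (∫⁻ ξ, ‖S.indicator h ξ‖ₑ ^ 2) / ENNReal.ofReal (t / 2) ^ 2 := by
      exact ENNReal.div_le_div_right (lintegral_enorm_fourierInv_sq_le (hh.indicator hS)) _
    _ = _ := by
      rw [ht2, div_eq_mul_inv, inv_inv, mul_comm]
      congr 1
      refine lintegral_congr fun ξ => ?_
      by_cases hξ : ξ ∈ S <;> simp [hξ]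

theorem setLIntegral_Ioc_rpow {r M : ℝ} (hr : -1 < r) (hM : 0 ≤ M) :
    ∫⁻ t in Set.Ioc 0 M, ENNReal.ofReal (t ^ r) = ENNReal.ofReal (M ^ (r + 1) / (r + 1)) := by
  rw [← ofReal_integral_eq_lintegral_ofReal (intervalIntegral.intervalIntegrable_rpow' hr).1
    (ae_restrict_of_forall_mem measurableSet_Ioc fun t ht => Real.rpow_nonneg ht.1.le _),
    ← intervalIntegral.integral_of_le hM, integral_rpow (.inl hr),
    Real.zero_rpow (by linarith), sub_zero]

theorem lintegral_norm_fourierInv_rpow_le {s K N p : ℝ} (hs0 : 0 < s) (hs : s < 1)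
    (hp : p = 2 / (1 - s)) (hK0 : 0 < K) (hN : 0 < N)
    (hK : ∀ R : ℝ, 0 < R →
      ∫⁻ x in Metric.ball (0 : Plane) R, ENNReal.ofReal (‖x‖ ^ (-(2 * s))) ≤
        ENNReal.ofReal (K * R ^ (1 - s)) ^ 2) {h : Plane → ℂ} (hh : Integrable h)
    (hhN : (∫⁻ ξ, ‖ξ‖ₑ ^ (2 * s) * ‖h ξ‖ₑ ^ 2) ^ (1 / 2 : ℝ) = ENNReal.ofReal N) :
    ∫⁻ x, ENNReal.ofReal (‖𝓕⁻ h x‖ ^ p) ≤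
      ENNReal.ofReal (4 * p * (2 * K) ^ (p - 2) / (p - 2) * N ^ p) := by
  have hs' : 0 < 1 - s := by linarith
  have hp2 : 2 < p := by rw [hp, lt_div_iff₀ hs']; linarith
  have hps : (1 - s) * (p - 2) = 2 * s := by rw [hp]; field_simp; ring
  set M : Plane → ℝ := fun ξ => 2 * K * N * ‖ξ‖ ^ (1 - s)
  have hM0 : ∀ ξ, 0 ≤ M ξ := fun ξ => by positivity
  have hMm : Measurable M := (measurable_norm.pow_const _).const_mul _
  have hN2 : ∫⁻ ξ, ‖ξ‖ₑ ^ (2 * s) * ‖h ξ‖ₑ ^ 2 = ENNReal.ofReal (N ^ 2) := by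
    rw [ENNReal.ofReal_pow hN.le, ← hhN, ← ENNReal.rpow_natCast, ← ENNReal.rpow_mul]
    norm_num
  set F : ℝ → Plane → ℝ≥0∞ := fun t ξ =>
    {q : ℝ × Plane | q.1 ≤ M q.2}.indicator
      (fun q => ENNReal.ofReal (4 * q.1 ^ (p - 3)) * ‖h q.2‖ₑ ^ 2) (t, ξ)
  have hFm : AEMeasurable (Function.uncurry F) ((volume.restrict (Set.Ioi 0)).prod volume) := by
    have h1 : Measurable fun q : ℝ × Plane => ENNReal.ofReal (4 * q.1 ^ (p - 3)) :=
      ((measurable_fst.pow_const _).const_mul 4).ennreal_ofReal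
    have h2 : AEMeasurable (fun q : ℝ × Plane => ‖h q.2‖ₑ ^ 2)
        ((volume.restrict (Set.Ioi 0)).prod volume) := hh.1.comp_snd.enorm.pow_const 2
    exact (h1.aemeasurable.mul h2).indicator
      (measurableSet_le measurable_fst (hMm.comp measurable_snd))
  have hinner : ∀ ξ, ∫⁻ t in Set.Ioi 0, F t ξ =
      ENNReal.ofReal (4 * (2 * K * N) ^ (p - 2) / (p - 2)) * (‖ξ‖ₑ ^ (2 * s) * ‖h ξ‖ₑ ^ 2) := by
    intro ξ
    have h1 : ∀ t, F t ξ = (Set.Iic (M ξ)).indicator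
        (fun t => ENNReal.ofReal 4 * ENNReal.ofReal (t ^ (p - 3)) * ‖h ξ‖ₑ ^ 2) t := fun t => by
      simp only [F, Set.indicator, Set.mem_ofPred_eq, Set.mem_Iic]
      rw [ENNReal.ofReal_mul (by norm_num)]
    simp only [h1]
    rw [lintegral_indicator measurableSet_Iic, Measure.restrict_restrict measurableSet_Iic,
      Set.inter_comm, Set.Ioi_inter_Iic, lintegral_mul_const' _ _ (by simp),
      lintegral_const_mul' _ _ (by simp), setLIntegral_Ioc_rpow (by linarith) (hM0 ξ),
      ← ENNReal.ofReal_mul (by norm_num), ← mul_assoc]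
    congr 1
    rw [← ofReal_norm, ENNReal.ofReal_rpow_of_nonneg (norm_nonneg _) (by positivity),
      ← ENNReal.ofReal_mul (by have : 0 < p - 2 := by linarith
                               positivity)]
    congr 1
    have : p - 3 + 1 = p - 2 := by ring
    rw [this, Real.mul_rpow (by positivity) (by positivity), ← Real.rpow_mul (norm_nonneg _), hps]
    ring
  rw [lintegral_rpow_eq_lintegral_meas_lt_mul volume (.of_forall fun x => norm_nonneg _)
    (continuous_fourierInv_of_integrable hh).norm.measurable.aemeasurable (by linarith)]
  calc _ ≤ ENNReal.ofReal p * ∫⁻ t in Set.Ioi 0, ∫⁻ ξ, F t ξ := by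
        refine mul_le_mul_right ?_ _
        refine setLIntegral_mono' measurableSet_Ioi fun t ht => ?_
        have ht' : 0 < t := ht
        grw [measure_lt_norm_fourierInv_le hs hK0 hN hK hh hhN ht']
        rw [mul_right_comm, ← ENNReal.ofReal_mul (by positivity), mul_assoc,
          ← Real.rpow_add ht', ← lintegral_const_mul' _ _ ENNReal.ofReal_ne_top]
        refine lintegral_mono fun ξ => ?_
        have h3 : (-2 : ℝ) + (p - 1) = p - 3 := by ring
        simp only [F, Set.indicator, Set.mem_ofPred_eq, h3, M]
        split_ifs <;> simp
    _ = ENNReal.ofReal p * ∫⁻ ξ, ∫⁻ t in Set.Ioi 0, F t ξ := by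
        rw [lintegral_lintegral_swap hFm]
    _ = _ := by
        have hp3 : 0 < p - 2 := by linarith
        simp only [hinner]
        rw [lintegral_const_mul' _ _ (by simp), hN2, ← ENNReal.ofReal_mul (by positivity),
          ← ENNReal.ofReal_mul (by linarith)]
        congr 1
        have h4 : N ^ p = N ^ (p - 2) * N ^ 2 := by
          rw [← Real.rpow_natCast, ← Real.rpow_add hN]
          norm_num
        rw [h4, Real.mul_rpow (by positivity) hN.le]
        ring

/-- The Sobolev embedding `Ḣ^s ⊂ L^p`, `p = 2 / (1 - s)`, in the plane, proved by splitting into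
low and high frequencies at a height-dependent threshold. -/
theorem exists_eLpNorm_fourierInv_le {s p : ℝ} (hs0 : 0 < s) (hs : s < 1)
    (hp : p = 2 / (1 - s)) :
    ∃ C : ℝ≥0, ∀ h : Plane → ℂ, Integrable h →
      eLpNorm (𝓕⁻ h) (ENNReal.ofReal p) volume ≤
        C * (∫⁻ ξ, ‖ξ‖ₑ ^ (2 * s) * ‖h ξ‖ₑ ^ 2) ^ (1 / 2 : ℝ) := by
  have hs' : 0 < 1 - s := by linarith
  have hp0 : 0 < p := by rw [hp]; positivity
  have hp2 : 0 < p - 2 := by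
    have : 2 < p := by rw [hp, lt_div_iff₀ hs']; linarith
    linarith
  obtain ⟨K, hK0, hK⟩ := exists_lintegral_ball_norm_rpow_le hs
  set C : ℝ := 4 * p * (2 * K) ^ (p - 2) / (p - 2)
  have hC : 0 < C := by positivity
  refine ⟨(C ^ p⁻¹).toNNReal, fun h hh => ?_⟩
  set Q := ∫⁻ ξ, ‖ξ‖ₑ ^ (2 * s) * ‖h ξ‖ₑ ^ 2
  change _ ≤ ENNReal.ofReal (C ^ p⁻¹) * _
  rcases eq_or_ne Q ∞ with hQ | hQ
  · rw [hQ, ENNReal.top_rpow_of_pos (by norm_num), ENNReal.mul_top]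
    · exact le_top
    · simp only [ne_eq, ENNReal.ofReal_eq_zero, not_le]
      positivity
  rcases eq_or_ne Q 0 with hQ0 | hQ0
  · have hm : AEMeasurable (fun ξ => ‖ξ‖ₑ ^ (2 * s) * ‖h ξ‖ₑ ^ 2) :=
      AEMeasurable.mul (by fun_prop) (hh.1.enorm.pow_const 2)
    have h0 : ∀ᵐ x : Plane, x ≠ 0 := by simp [ae_iff]
    have hz : h =ᵐ[volume] 0 := by
      filter_upwards [(lintegral_eq_zero_iff' hm).1 hQ0, h0] with ξ hξ hξ0
      simpa [hs0.le, hξ0, hs0.not_gt] using hξ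
    have : 𝓕⁻ h = 0 := by
      ext x
      rw [Real.fourierInv_congr_ae hz]
      simp [Real.fourierInv_eq]
    rw [this]
    simp
  set N : ℝ := (Q ^ (1 / 2 : ℝ)).toReal
  have hQt : Q ^ (1 / 2 : ℝ) ≠ ∞ := ENNReal.rpow_ne_top_of_nonneg (by norm_num) hQ
  have hQN : Q ^ (1 / 2 : ℝ) = ENNReal.ofReal N := (ENNReal.ofReal_toReal hQt).symm
  have hN : 0 < N := ENNReal.toReal_pos (by simp [hQ0, hQ]) hQt
  have key := lintegral_norm_fourierInv_rpow_le hs0 hs hp hK0 hN hK hh hQN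
  rw [eLpNorm_eq_lintegral_rpow_enorm_toReal (by simpa using hp0) (by simp),
    ENNReal.toReal_ofReal hp0.le, hQN, ← ENNReal.ofReal_mul (by positivity), one_div,
    ENNReal.rpow_inv_le_iff hp0, ENNReal.ofReal_rpow_of_nonneg (by positivity) hp0.le,
    Real.mul_rpow (by positivity) hN.le, Real.rpow_inv_rpow hC.le hp0.ne']
  refine le_trans (le_of_eq (lintegral_congr fun x => ?_)) key
  rw [← ofReal_norm, ENNReal.ofReal_rpow_of_nonneg (norm_nonneg _) hp0.le]

theorem holderTriple_three_three : ENNReal.HolderTriple 3 3 (3 / 2) := ⟨by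
  rw [← ENNReal.toReal_eq_toReal_iff' (by simp) (by simp), ENNReal.toReal_add (by simp) (by simp)]
  simp
  norm_num⟩

theorem holderTriple_six_three : ENNReal.HolderTriple 6 3 2 := ⟨by
  rw [← ENNReal.toReal_eq_toReal_iff' (by simp) (by simp), ENNReal.toReal_add (by simp) (by simp)]
  simp
  norm_num⟩

theorem holderTriple_three_halves_three : ENNReal.HolderTriple (3 / 2) 3 1 := ⟨by
  rw [← ENNReal.toReal_eq_toReal_iff' (by simp) (by simp), ENNReal.toReal_add (by simp) (by simp)]
  simp
  norm_num⟩

theorem SchwartzMap.integrable_norm_rpow_mul (f : 𝓢(Plane, ℂ)) {a : ℝ} (ha0 : 0 ≤ a) (ha : a < 2) :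
    Integrable fun ξ => ((‖ξ‖ ^ (-a) : ℝ) : ℂ) * f ξ := by
  have hm : AEStronglyMeasurable (fun ξ => ((‖ξ‖ ^ (-a) : ℝ) : ℂ) * f ξ) :=
    (Complex.measurable_ofReal.comp (measurable_norm.pow_const _)).aestronglyMeasurable.mul
      f.continuous.aestronglyMeasurable
  have hn : ∀ ξ, ‖((‖ξ‖ ^ (-a) : ℝ) : ℂ) * f ξ‖ = ‖ξ‖ ^ (-a) * ‖f ξ‖ := fun ξ => by
    rw [norm_mul, Complex.norm_real, Real.norm_of_nonneg (by positivity)]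
  rw [← integrableOn_univ, ← Set.union_compl_self (Metric.ball (0 : Plane) 1)]
  refine IntegrableOn.union ?_ ?_
  · refine integrableOn_ball_of_norm_le_rpow (C := SchwartzMap.seminorm ℂ 0 0 f) (α := a)
      (by simp) (by simpa using ha) (.of_forall fun ξ => ?_) hm
    rw [hn, mul_comm]
    gcongr
    exact norm_le_seminorm ℂ f ξ
  · refine Integrable.mono f.integrable.integrableOn hm.restrict
      (ae_restrict_of_forall_mem measurableSet_ball.compl fun ξ hξ => ?_)
    rw [hn]
    refine mul_le_of_le_one_left (norm_nonneg _) ?_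
    refine Real.rpow_le_one_of_one_le_of_nonpos ?_ (by linarith)
    simpa using hξ

theorem SchwartzMap.lintegral_norm_rpow_mul_fourier_sq_lt_top (f : 𝓢(Plane, ℂ)) :
    ∫⁻ ξ, ENNReal.ofReal (‖ξ‖ ^ (-(2 / 3) : ℝ) * ‖𝓕 f ξ‖ ^ 2) < ∞ := by
  have h := ((𝓕 f).integrable_norm_rpow_mul (a := 2 / 3) (by norm_num) (by norm_num)).mul_bdd
    (𝓕 f).continuous.aestronglyMeasurable (.of_forall (norm_le_seminorm ℂ (𝓕 f)))
  refine lt_of_le_of_lt (le_of_eq (lintegral_congr fun ξ => ?_)) h.2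
  rw [← ofReal_norm, norm_mul, norm_mul, Complex.norm_real, Real.norm_of_nonneg (by positivity)]
  congr 1
  ring

theorem fourier_conj_eq_conj_fourierInv (k : Plane → ℂ) (x : Plane) :
    𝓕 (fun ξ => (starRingEnd ℂ) (k ξ)) x = (starRingEnd ℂ) (𝓕⁻ k x) := by
  rw [Real.fourier_eq, Real.fourierInv_eq, ← integral_conj]
  refine integral_congr_ae (.of_forall fun ξ => ?_)
  simp [Circle.smul_def, AddChar.map_neg_eq_inv]

/-- The dual Sobolev inequality `L^{3/2} ⊂ Ḣ^{-1/3}` in the plane. -/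
theorem exists_dual_sobolev :
    ∃ C : ℝ≥0, ∀ f : 𝓢(Plane, ℂ),
      (∫⁻ ξ, ENNReal.ofReal (‖ξ‖ ^ (-(2 / 3) : ℝ) * ‖𝓕 f ξ‖ ^ 2)) ^ (1 / 2 : ℝ) ≤
        C * eLpNorm f (3 / 2) volume := by
  obtain ⟨C, hC⟩ := exists_eLpNorm_fourierInv_le (s := 1 / 3) (p := 3) (by norm_num) (by norm_num)
    (by norm_num)
  refine ⟨C, fun f => ?_⟩
  set D := ∫⁻ ξ, ENNReal.ofReal (‖ξ‖ ^ (-(2 / 3) : ℝ) * ‖𝓕 f ξ‖ ^ 2)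
  set k : Plane → ℂ := fun ξ => ((‖ξ‖ ^ (-(2 / 3) : ℝ) : ℝ) : ℂ) * 𝓕 f ξ
  have hk : Integrable k := (𝓕 f).integrable_norm_rpow_mul (by norm_num) (by norm_num)
  have hk' : Integrable fun ξ => (starRingEnd ℂ) (k ξ) :=
    (LinearIsometryEquiv.integrable_comp_iff Complex.conjLIE).2 hk
  have hD : D ≠ ∞ := f.lintegral_norm_rpow_mul_fourier_sq_lt_top.ne
  have hkD : ∫⁻ ξ, ‖ξ‖ₑ ^ (2 * (1 / 3) : ℝ) * ‖k ξ‖ₑ ^ 2 = D := by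
    refine lintegral_congr fun ξ => ?_
    rw [← ofReal_norm, ← ofReal_norm, ENNReal.ofReal_rpow_of_nonneg (norm_nonneg _) (by norm_num),
      ← ENNReal.ofReal_pow (norm_nonneg _), ← ENNReal.ofReal_mul (by positivity)]
    congr 1
    simp only [k]
    rw [norm_mul, Complex.norm_real, Real.norm_of_nonneg (by positivity), mul_pow, ← mul_assoc]
    congr 1
    rcases eq_or_ne ξ 0 with rfl | hξ
    · norm_num
    · have hξ' : 0 < ‖ξ‖ := norm_pos_iff.2 hξ
      rw [← Real.rpow_natCast, ← Real.rpow_mul hξ'.le, ← Real.rpow_add hξ']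
      norm_num
  have h3 : eLpNorm (𝓕⁻ k) 3 volume ≤ C * D ^ (1 / 2 : ℝ) := by
    have := hC k hk
    rwa [hkD, ENNReal.ofReal_ofNat] at this
  have hself : D ≤ eLpNorm f (3 / 2) volume * eLpNorm (𝓕⁻ k) 3 volume := by
    have hflip := integral_fourier_mul_eq_of_integrable f.integrable hk'
    have hint : ∀ ξ, 𝓕 (f : Plane → ℂ) ξ * (starRingEnd ℂ) (k ξ) =
        ((‖ξ‖ ^ (-(2 / 3) : ℝ) * ‖𝓕 f ξ‖ ^ 2 : ℝ) : ℂ) := fun ξ => by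
      simp only [k, map_mul, Complex.conj_ofReal, ← SchwartzMap.fourier_coe]
      rw [mul_left_comm, Complex.mul_conj, Complex.normSq_eq_norm_sq]
      push_cast
      ring
    have hDint : D = ‖∫ ξ, 𝓕 (f : Plane → ℂ) ξ * (starRingEnd ℂ) (k ξ)‖ₑ := by
      simp only [hint]
      rw [integral_complex_ofReal, ← ofReal_norm, Complex.norm_real,
        Real.norm_of_nonneg (integral_nonneg fun ξ => by positivity),
        ofReal_integral_eq_lintegral_ofReal _ (.of_forall fun ξ => by positivity)]
      refine ⟨?_, ?_⟩
      · exact ((measurable_norm.pow_const _).mul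
          ((𝓕 f).continuous.norm.measurable.pow_const 2)).aestronglyMeasurable
      · refine lt_of_le_of_lt (le_of_eq (lintegral_congr fun ξ => ?_)) hD.lt_top
        rw [Real.enorm_of_nonneg (by positivity)]
    have := holderTriple_three_halves_three
    calc D = ‖∫ x, f x * 𝓕 (fun ξ => (starRingEnd ℂ) (k ξ)) x‖ₑ := by rw [hDint, hflip]
      _ ≤ ∫⁻ x, ‖f x * 𝓕 (fun ξ => (starRingEnd ℂ) (k ξ)) x‖ₑ :=
        enorm_integral_le_lintegral_enorm _
      _ = eLpNorm (⇑f • 𝓕⁻ k) 1 volume := by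
        rw [eLpNorm_one_eq_lintegral_enorm]
        refine lintegral_congr fun x => ?_
        rw [fourier_conj_eq_conj_fourierInv, enorm_mul, RCLike.enorm_conj, ← enorm_mul,
          Pi.smul_apply', smul_eq_mul]
      _ ≤ _ := eLpNorm_smul_le_mul_eLpNorm
        (continuous_fourierInv_of_integrable hk).aestronglyMeasurable
        f.continuous.aestronglyMeasurable
  rcases eq_or_ne D 0 with hD0 | hD0
  · simp [hD0]
  have hsq : D = D ^ (1 / 2 : ℝ) * D ^ (1 / 2 : ℝ) := by
    rw [← ENNReal.rpow_add _ _ hD0 hD]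
    norm_num
  have hfin : D ^ (1 / 2 : ℝ) ≠ ∞ := ENNReal.rpow_ne_top_of_nonneg (by norm_num) hD
  have hpos : D ^ (1 / 2 : ℝ) ≠ 0 := by simp [hD0, hD]
  rw [← ENNReal.mul_le_mul_iff_left hpos hfin]
  calc D ^ (1 / 2 : ℝ) * D ^ (1 / 2 : ℝ) = D := hsq.symm
    _ ≤ _ := hself
    _ ≤ eLpNorm f (3 / 2) volume * (C * D ^ (1 / 2 : ℝ)) := by gcongr
    _ = _ := by ring

/-- The Hardy-Littlewood-Sobolev inequality `|∇|⁻¹ : L^{3/2} → L⁶` in the plane. -/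
theorem exists_eLpNorm_invAbs_le :
    ∃ C : ℝ≥0, ∀ f : 𝓢(Plane, ℂ),
      Continuous (invAbs f) ∧ eLpNorm (invAbs f) 6 volume ≤ C * eLpNorm f (3 / 2) volume := by
  obtain ⟨C₁, hC₁⟩ := exists_dual_sobolev
  obtain ⟨C₂, hC₂⟩ := exists_eLpNorm_fourierInv_le (s := 2 / 3) (p := 6) (by norm_num)
    (by norm_num) (by norm_num)
  refine ⟨C₂ * C₁, fun f => ?_⟩
  set h : Plane → ℂ := fun ξ => ((‖ξ‖ : ℂ))⁻¹ * 𝓕 (f : Plane → ℂ) ξ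
  have hh : Integrable h := by
    have := (𝓕 f).integrable_norm_rpow_mul (a := 1) (by norm_num) (by norm_num)
    simp only [Real.rpow_neg_one, Complex.ofReal_inv, SchwartzMap.fourier_coe] at this
    exact this
  have heq : invAbs f = 𝓕⁻ h := rfl
  have hint : ∫⁻ ξ, ‖ξ‖ₑ ^ (2 * (2 / 3) : ℝ) * ‖h ξ‖ₑ ^ 2 =
      ∫⁻ ξ, ENNReal.ofReal (‖ξ‖ ^ (-(2 / 3) : ℝ) * ‖𝓕 f ξ‖ ^ 2) := by
    refine lintegral_congr fun ξ => ?_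
    rw [← ofReal_norm, ← ofReal_norm, ENNReal.ofReal_rpow_of_nonneg (norm_nonneg _) (by norm_num),
      ← ENNReal.ofReal_pow (norm_nonneg _), ← ENNReal.ofReal_mul (by positivity)]
    congr 1
    simp only [h, ← SchwartzMap.fourier_coe]
    rw [norm_mul, norm_inv, Complex.norm_real, norm_norm, mul_pow, ← mul_assoc]
    congr 1
    rcases eq_or_ne ξ 0 with rfl | hξ
    · norm_num
    · have hξ' : 0 < ‖ξ‖ := norm_pos_iff.2 hξ
      rw [← Real.rpow_neg_one, ← Real.rpow_natCast, ← Real.rpow_mul hξ'.le, ← Real.rpow_add hξ']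
      norm_num
  rw [heq]
  refine ⟨continuous_fourierInv_of_integrable hh, ?_⟩
  have := hC₂ h hh
  rw [hint, ENNReal.ofReal_ofNat] at this
  grw [this, hC₁ f]
  rw [ENNReal.coe_mul, mul_assoc]

theorem exists_eLpNorm_three_le_sobNorm :
    ∃ C : ℝ≥0, ∀ ψ : 𝓢(Plane, Fin 2 → ℂ),
      eLpNorm ψ 3 volume ≤ C * sobNorm (1 / 3) (fun x => ψ x) := by
  obtain ⟨C, hC⟩ := exists_eLpNorm_fourierInv_le (s := 1 / 3) (p := 3) (by norm_num) (by norm_num)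
    (by norm_num)
  refine ⟨C + C, fun ψ => ?_⟩
  have hcomp : ∀ i, eLpNorm (fun x => ψ x i) 3 volume ≤ C * sobNorm (1 / 3) (fun x => ψ x) := by
    intro i
    set φ : 𝓢(Plane, ℂ) := postcompCLM (ContinuousLinearMap.proj (R := ℂ) (φ := fun _ => ℂ) i) ψ
    have hφ : ∀ x, φ x = ψ x i := fun x => rfl
    have hF : ∀ ξ, 𝓕 φ ξ = 𝓕 (fun x => ψ x) ξ i := fun ξ => by
      rw [SchwartzMap.fourier_coe, Real.fourier_eq, Real.fourier_eq]
      exact ContinuousLinearMap.integral_comp_comm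
        (ContinuousLinearMap.proj (R := ℂ) (φ := fun _ => ℂ) i)
        ((Real.fourierIntegral_convergent_iff ξ).2 ψ.integrable)
    have h1 := hC (𝓕 φ : 𝓢(Plane, ℂ)) (𝓕 φ : 𝓢(Plane, ℂ)).integrable
    rw [← SchwartzMap.fourierInv_coe, FourierTransform.fourierInv_fourier_eq,
      ENNReal.ofReal_ofNat] at h1
    refine h1.trans ?_
    unfold sobNorm
    gcongr with ξ
    rw [← ofReal_norm, ← ofReal_norm, ENNReal.ofReal_rpow_of_nonneg (norm_nonneg _) (by norm_num),
      ← ENNReal.ofReal_pow (norm_nonneg _), ← ENNReal.ofReal_mul (by positivity)]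
    apply ENNReal.ofReal_le_ofReal
    rw [Real.rpow_mul (norm_nonneg _), hF]
    gcongr
    · rw [Real.rpow_two]
      linarith
    · exact norm_le_pi_norm _ i
  have hm : ∀ i, AEStronglyMeasurable (fun x => ‖ψ x i‖) volume := fun i =>
    ((continuous_apply i).comp ψ.continuous).norm.aestronglyMeasurable
  calc eLpNorm ψ 3 volume
      ≤ eLpNorm ((fun x => ‖ψ x 0‖) + fun x => ‖ψ x 1‖) 3 volume := by
        refine eLpNorm_mono_real fun x => ?_
        refine (pi_norm_le_iff_of_nonneg (by simp only [Pi.add_apply]; positivity)).2 fun i => ?_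
        fin_cases i <;> simp
    _ ≤ eLpNorm (fun x => ‖ψ x 0‖) 3 volume + eLpNorm (fun x => ‖ψ x 1‖) 3 volume :=
        eLpNorm_add_le (hm 0) (hm 1) (by norm_num)
    _ ≤ _ := by
        rw [eLpNorm_norm, eLpNorm_norm, ENNReal.coe_add, add_mul]
        exact add_le_add (hcomp 0) (hcomp 1)

/-- The pointwise inner product `⟨ψ₁, ψ₂⟩` of Schwartz functions, as a Schwartz function. -/
def schwartzDotc (ψ₁ ψ₂ : 𝓢(Plane, Fin 2 → ℂ)) : 𝓢(Plane, ℂ) :=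
  ∑ i, pairing (ContinuousLinearMap.mul ℂ ℂ)
    (postcompCLM ((Complex.conjCLE : ℂ →L[ℝ] ℂ) ∘L
      ContinuousLinearMap.proj (R := ℝ) (φ := fun _ => ℂ) i) ψ₁)
    (postcompCLM (ContinuousLinearMap.proj (R := ℂ) (φ := fun _ => ℂ) i) ψ₂)

theorem coe_schwartzDotc (ψ₁ ψ₂ : 𝓢(Plane, Fin 2 → ℂ)) :
    (schwartzDotc ψ₁ ψ₂ : Plane → ℂ) = fun y => dotc (ψ₁ y) (ψ₂ y) := by
  ext y
  simp [schwartzDotc, dotc]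

theorem norm_dotc_le (u v : Fin 2 → ℂ) : ‖dotc u v‖ ≤ 2 * ‖u‖ * ‖v‖ := by
  refine (norm_sum_le _ _).trans ?_
  calc ∑ i, ‖(starRingEnd ℂ) (u i) * v i‖ ≤ ∑ _i : Fin 2, ‖u‖ * ‖v‖ := by
        refine Finset.sum_le_sum fun i _ => ?_
        rw [norm_mul, RCLike.norm_conj]
        gcongr <;> exact norm_le_pi_norm _ i
    _ = _ := by simp [mul_assoc]

/-- ‖ |∇|⁻¹(⟨ψ₁,ψ₂⟩) ψ₃ ‖_{L²(ℝ²)} ≲ ‖ψ₁‖_{H^{1/3}}‖ψ₂‖_{H^{1/3}}‖ψ₃‖_{H^{1/3}}. -/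
theorem stmt_11 :
    ∃ C : ℝ≥0, ∀ ψ₁ ψ₂ ψ₃ : SchwartzMap (EuclideanSpace ℝ (Fin 2)) (Fin 2 → ℂ),
      eLpNorm (fun x => invAbs (fun y => dotc (ψ₁ y) (ψ₂ y)) x • ψ₃ x) 2 volume
        ≤ (C : ℝ≥0∞) * sobNorm (1 / 3) (fun x => ψ₁ x)
            * sobNorm (1 / 3) (fun x => ψ₂ x) * sobNorm (1 / 3) (fun x => ψ₃ x) := by
  obtain ⟨A, hA⟩ := exists_eLpNorm_invAbs_le
  obtain ⟨B, hB⟩ := exists_eLpNorm_three_le_sobNorm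
  refine ⟨A * 2 * B ^ 3, fun ψ₁ ψ₂ ψ₃ => ?_⟩
  obtain ⟨hcont, hbound⟩ := hA (schwartzDotc ψ₁ ψ₂)
  rw [coe_schwartzDotc] at hcont hbound
  have := holderTriple_six_three
  have := holderTriple_three_three
  have hdot : eLpNorm (fun y => dotc (ψ₁ y) (ψ₂ y)) (3 / 2) volume ≤
      (2 : ℝ≥0) * eLpNorm ψ₁ 3 volume * eLpNorm ψ₂ 3 volume :=
    eLpNorm_le_eLpNorm_mul_eLpNorm'_of_norm ψ₁.continuous.aestronglyMeasurable
      ψ₂.continuous.aestronglyMeasurable dotc 2 (.of_forall fun x => norm_dotc_le _ _)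
  calc _ ≤ eLpNorm (invAbs fun y => dotc (ψ₁ y) (ψ₂ y)) 6 volume * eLpNorm ψ₃ 3 volume :=
        eLpNorm_smul_le_mul_eLpNorm ψ₃.continuous.aestronglyMeasurable hcont.aestronglyMeasurable
    _ ≤ A * ((2 : ℝ≥0) * (B * sobNorm (1 / 3) fun x => ψ₁ x) *
          (B * sobNorm (1 / 3) fun x => ψ₂ x)) *
        (B * sobNorm (1 / 3) fun x => ψ₃ x) := by
        grw [hbound, hdot, hB ψ₁, hB ψ₂, hB ψ₃]
    _ = _ := by
        push_cast
        ring

end
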